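/- arXiv:1407.8498 — 2 statements merged into one kernel-verified Lean document; each statement's English description precedes it below -/
import Mathlib

section
/- Let q = 2^h (h ≥ 1) and F = GF(q²). Let a,b,c,d,e,f ∈ F with c ≠ 0 and Tr(ab/c²) = 0 (hyperbolic case). Then the number of triples (x,y,z) ∈ F³ satisfying both z^q + z = x^{q+1} + y^{q+1} and z = ax² + by² + cxy + dx + ey + f belongs to the set {q², q³ − q², q³ − q² + q, q³ − q, q³, q³ + q, q³ + q² − q, q³ + q², 2q³ − q²}. -/
section helpers

open Finset

theorem aux_char_sum {A : Type*} [AddCommGroup A] [Fintype A] (φ : A → ℤ)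
    (hadd : ∀ a b, φ (a + b) = φ a * φ b) (a0 : A) (h0 : φ a0 ≠ 1) :
    ∑ a, φ a = 0 := by
  have h1 : ∑ a, φ a = φ a0 * ∑ a, φ a := by
    rw [Finset.mul_sum]
    rw [← Equiv.sum_comp (Equiv.addLeft a0) φ]
    exact Finset.sum_congr rfl (fun a _ => by simp [hadd])
  have h2 : (φ a0 - 1) * ∑ a, φ a = 0 := by linarith
  rcases mul_eq_zero.mp h2 with h | h
  · exact absurd (by linarith) h0
  · exact h

theorem aux_exists_char (K : Type*) [Field K] [CharP K 2] :
    ∃ χ : K → ℤ, (∀ a b, χ (a + b) = χ a * χ b) ∧ (∀ a, χ a * χ a = 1) ∧ ∃ t, χ t ≠ 1 := by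
  let : Algebra (ZMod 2) K := ZMod.algebra K 2
  obtain ⟨f, hf⟩ : ∃ f : Module.Dual (ZMod 2) K, f 1 ≠ 0 := by
    by_contra hcon
    push Not at hcon
    exact one_ne_zero ((Module.forall_dual_apply_eq_zero_iff (ZMod 2) (1 : K)).mp hcon)
  refine ⟨fun x => if f x = 0 then 1 else -1, ?_, ?_, 1, ?_⟩
  · intro a b
    simp only [map_add]
    generalize f a = u
    generalize f b = v
    revert u v
    decide
  · intro a
    dsimp only
    split_ifs <;> norm_num
  · simp [hf]

section general

variable {K V : Type*} [Field K] [Fintype K] [CharP K 2]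
  [AddCommGroup V] [Module K V] [Fintype V]

theorem aux_linear_sum (χ : K → ℤ) (hadd : ∀ a b, χ (a + b) = χ a * χ b)
    (hne : ∃ t, χ t ≠ 1) (ℓ : V → K) (hℓ : ∀ v w, ℓ (v + w) = ℓ v + ℓ w)
    (hs : ∀ (s : K) v, ℓ (s • v) = s * ℓ v) (v0 : V) (h0 : ℓ v0 ≠ 0) :
    ∑ v, χ (ℓ v) = 0 := by
  obtain ⟨t, ht⟩ := hne
  refine aux_char_sum (fun v => χ (ℓ v)) (fun a b => by simp [hℓ, hadd]) ((t / ℓ v0) • v0) ?_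
  simp only [hs]
  rwa [div_mul_cancel₀ _ h0]

theorem aux_sq (χ : K → ℤ) (hadd : ∀ a b, χ (a + b) = χ a * χ b)
    (hsq : ∀ a, χ a * χ a = 1) (hne : ∃ t, χ t ≠ 1)
    (Q : V → K) (B : V →ₗ[K] V →ₗ[K] K)
    (hQ : ∀ v w, Q (v + w) = Q v + Q w + B v w)
    (ℓ : V →ₗ[K] K) (R : Submodule K V) (hR : ∀ w, w ∈ R ↔ ∀ v, B v w = 0) :
    (∑ v, χ (Q v + ℓ v) = 0 ∧ ¬ ∀ w ∈ R, χ (Q w + ℓ w) = 1) ∨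
    ((∑ v, χ (Q v + ℓ v)) ^ 2 = Fintype.card V * Nat.card R ∧ ∀ w ∈ R, χ (Q w + ℓ w) = 1) := by
  classical
  have key : (∑ v, χ (Q v + ℓ v)) ^ 2
      = Fintype.card V * ∑ w : R, χ (Q w + ℓ w) := by
    have h1 : ∀ w : V, ∑ v, χ (B v w) = if w ∈ R then (Fintype.card V : ℤ) else 0 := by
      intro w
      split_ifs with hw
      · have h01 : χ 0 = 1 := by
          have h := hadd 0 0
          have h' := hsq 0
          rw [add_zero] at h
          linarith
        rw [hR] at hw
        simp [hw, h01]
      · rw [hR] at hw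
        push Not at hw
        obtain ⟨v0, hv0⟩ := hw
        exact aux_linear_sum χ hadd hne (fun v => B v w) (by simp) (by simp) v0 hv0
    rw [sq, Finset.sum_mul_sum]
    have h2 : ∀ v : V, ∑ w, χ (Q v + ℓ v) * χ (Q w + ℓ w)
        = ∑ w, χ (Q w + ℓ w) * χ (B v w) := by
      intro v
      rw [← Equiv.sum_comp (Equiv.addLeft v)]
      refine Finset.sum_congr rfl (fun w _ => ?_)
      simp only [Equiv.coe_addLeft, hQ, map_add]
      have : Q v + Q w + B v w + (ℓ v + ℓ w) = (Q v + ℓ v) + ((Q w + ℓ w) + B v w) := by ring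
      rw [this, hadd (Q v + ℓ v), ← mul_assoc, hsq, one_mul, hadd (Q w + ℓ w)]
    simp_rw [h2]
    rw [Finset.sum_comm]
    simp_rw [← Finset.mul_sum, h1]
    simp only [mul_ite, mul_zero]
    rw [← Finset.sum_filter, ← Finset.sum_mul, mul_comm]
    congr 1
    exact Finset.sum_subtype _ (by simp) (fun w => χ (Q w + ℓ w))
  by_cases hall : ∀ w ∈ R, χ (Q w + ℓ w) = 1
  · right
    refine ⟨?_, hall⟩
    rw [key]
    congr 1
    rw [Finset.sum_congr rfl (fun (w : R) _ => hall w w.2)]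
    simp
  · left
    refine ⟨?_, hall⟩
    push Not at hall
    obtain ⟨w0, hw0, h0⟩ := hall
    have : ∑ w : R, χ (Q w + ℓ w) = 0 := by
      refine aux_char_sum (fun w : R => χ (Q w + ℓ w)) (fun a b => ?_) ⟨w0, hw0⟩ h0
      simp only [Submodule.coe_add, hQ, map_add, (hR b).mp b.2, add_zero]
      rw [← hadd]
      congr 1
      ring
    rw [this, mul_zero] at key
    exact pow_eq_zero_iff (two_ne_zero) |>.mp key

theorem aux_general (q : ℕ) (hq : 0 < q) (hK : Fintype.card K = q) (hV : Fintype.card V = q ^ 4)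
    (Q : V → K) (B : V →ₗ[K] V →ₗ[K] K)
    (hQ : ∀ v w, Q (v + w) = Q v + Q w + B v w)
    (hQs : ∀ (s : K) v, Q (s • v) = s ^ 2 * Q v)
    (L : V →ₗ[K] K) (k : K) (R : Submodule K V) (hR : ∀ w, w ∈ R ↔ ∀ v, B v w = 0)
    (hB : ∀ v w, B v w = B w v)
    (hRc : Nat.card R = 1 ∨ Nat.card R = q ^ 2) (N : ℕ)
    (hN : N = Nat.card {v : V // Q v + L v + k = 0}) :
    ∃ s : ℤ, (s = 1 ∨ s = -1) ∧ ((N : ℤ) = q ^ 3 + s * (q ^ 2 - q) ∨ (N : ℤ) = q ^ 3 + s * q ∨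
      (N : ℤ) = q ^ 3 ∨ (N : ℤ) = q ^ 3 + s * q ^ 2 ∨ (N : ℤ) = q ^ 3 + s * (q ^ 3 - q ^ 2)) := by
  classical
  have : Finite V := inferInstance
  obtain ⟨χ, hadd, hsq, hne⟩ := aux_exists_char K
  have h01 : χ 0 = 1 := by
    have h := hadd 0 0
    have h' := hsq 0
    rw [add_zero] at h
    linarith
  have h2 : (2 : K) = 0 := CharTwo.two_eq_zero
  have hqz : (q : ℤ) ≠ 0 := by exact_mod_cast hq.ne'
  -- squaring is a bijection
  have hbij : Function.Bijective (fun m : K => m ^ 2) := by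
    apply Finite.injective_iff_bijective.mp
    intro x y hxy
    have h3 : (x - y) ^ 2 = 0 := by
      have : (x - y) ^ 2 = x ^ 2 - y ^ 2 + 2 * (y ^ 2 - x * y) := by ring
      rw [this, h2]
      simp only at hxy
      rw [hxy]; ring
    exact sub_eq_zero.mp (pow_eq_zero_iff two_ne_zero |>.mp h3)
  have hKsum : ∀ b : K, ∑ m : K, χ (m ^ 2 * b) = if b = 0 then (q : ℤ) else 0 := by
    intro b
    rw [Function.Bijective.sum_comp hbij (fun m => χ (m * b))]
    split_ifs with hb
    · simp [hb, h01, hK]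
    · refine aux_linear_sum (V := K) χ hadd hne (fun m => m * b) ?_ ?_ 1 (by simpa using hb)
      · intro v w; ring
      · intro v w; simp [mul_assoc]
  have hcount : (N : ℤ) * q = ∑ m : K, ∑ v : V, χ (m ^ 2 * (Q v + L v + k)) := by
    rw [Finset.sum_comm]
    simp_rw [hKsum]
    rw [← Finset.sum_filter, Finset.sum_const, nsmul_eq_mul]
    rw [hN, Nat.card_eq_fintype_card, Fintype.card_subtype]
  rw [← Finset.add_sum_erase _ _ (Finset.mem_univ (0 : K))] at hcount
  have hS : ∀ m ∈ (Finset.univ.erase (0 : K)), ∑ v : V, χ (m ^ 2 * (Q v + L v + k))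
      = χ (m ^ 2 * k) * ∑ v : V, χ (Q v + (m • L) v) := by
    intro m hm
    have hm0 : m ≠ 0 := Finset.ne_of_mem_erase hm
    rw [Finset.mul_sum,
      ← Equiv.sum_comp (MulAction.toPerm (Units.mk0 m hm0) : Equiv.Perm V)
        (fun v => χ (m ^ 2 * k) * χ (Q v + (m • L) v))]
    refine Finset.sum_congr rfl (fun v _ => ?_)
    rw [← hadd]
    congr 1
    have : (MulAction.toPerm (Units.mk0 m hm0) : Equiv.Perm V) v = m • v := rfl
    rw [this, hQs]
    simp
    ring
  rw [Finset.sum_congr rfl hS] at hcount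
  have hfirst : ∑ v : V, χ ((0 : K) ^ 2 * (Q v + L v + k)) = (q : ℤ) ^ 4 := by
    simp [h01, hV]
  rw [hfirst] at hcount
  have hRm : ∃ M : ℤ, (M = 1 ∨ M = q) ∧ (Nat.card R : ℤ) = M ^ 2 := by
    rcases hRc with h | h
    · exact ⟨1, Or.inl rfl, by rw [h]; norm_num⟩
    · exact ⟨q, Or.inr rfl, by rw [h]; push_cast; rfl⟩
  obtain ⟨M, hM, hRM⟩ := hRm
  have hA : ∀ ℓ : V →ₗ[K] K,
      (∑ v, χ (Q v + ℓ v) = 0 ∧ ¬ ∀ w ∈ R, χ (Q w + ℓ w) = 1) ∨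
      (∃ s : ℤ, (s = 1 ∨ s = -1) ∧ (∑ v, χ (Q v + ℓ v)) = s * (q ^ 2 * M)) ∧
        ∀ w ∈ R, χ (Q w + ℓ w) = 1 := by
    intro ℓ
    rcases aux_sq χ hadd hsq hne Q B hQ ℓ R hR with h | ⟨h, h'⟩
    · exact Or.inl h
    · refine Or.inr ⟨?_, h'⟩
      rw [hV, hRM] at h
      have : (∑ v, χ (Q v + ℓ v)) ^ 2 = (q ^ 2 * M) ^ 2 := by rw [h]; push_cast; ring
      rcases sq_eq_sq_iff_eq_or_eq_neg.mp this with h | h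
      · exact ⟨1, Or.inl rfl, by rw [h]; ring⟩
      · exact ⟨-1, Or.inr rfl, by rw [h]; ring⟩
  by_cases hL : ∀ r ∈ R, L r = 0
  · -- translate
    obtain ⟨v0, hv0⟩ : ∃ v0, ∀ v, L v = B v v0 := by
      have hmem : L ∈ (LinearMap.ker B).dualAnnihilator := by
        rw [Submodule.mem_dualAnnihilator]
        intro w hw
        apply hL
        rw [hR]
        intro v
        rw [hB, LinearMap.mem_ker.mp hw]
        rfl
      rw [← LinearMap.range_dualMap_eq_dualAnnihilator_ker] at hmem
      obtain ⟨φ, hφ⟩ := hmem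
      obtain ⟨v0, rfl⟩ := (Module.evalEquiv K V).surjective φ
      exact ⟨v0, fun v => by rw [← hφ]; rfl⟩
    set A := ∑ v, χ (Q v + (0 : V →ₗ[K] K) v) with hAdef
    have hS2 : ∀ m : K, χ (m ^ 2 * k) * ∑ v : V, χ (Q v + (m • L) v)
        = χ (m ^ 2 * (k + Q v0)) * A := by
      intro m
      rw [hAdef, ← Equiv.sum_comp (Equiv.addRight (m • v0))
        (fun v => χ (Q v + (0 : V →ₗ[K] K) v)), Finset.mul_sum, Finset.mul_sum]
      refine Finset.sum_congr rfl (fun v _ => ?_)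
      rw [← hadd, ← hadd]
      congr 1
      simp [hQ, hQs, hv0]
      linear_combination (-m ^ 2 * Q v0) * h2
    rw [Finset.sum_congr rfl (fun m _ => hS2 m), ← Finset.sum_mul] at hcount
    have h3 := hKsum (k + Q v0)
    rw [← Finset.add_sum_erase _ _ (Finset.mem_univ (0 : K))] at h3
    have h4 : ∑ m ∈ Finset.univ.erase (0 : K), χ (m ^ 2 * (k + Q v0))
        = (if k + Q v0 = 0 then (q : ℤ) else 0) - 1 := by
      rw [← h3]; simp [h01]
    rw [h4] at hcount
    rcases hA 0 with ⟨h, -⟩ | ⟨⟨s, hs, h⟩, -⟩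
    · refine ⟨1, Or.inl rfl, Or.inr (Or.inr (Or.inl ?_))⟩
      rw [← hAdef] at h
      rw [h] at hcount
      apply mul_right_cancel₀ hqz
      rw [hcount]; ring
    · rw [← hAdef] at h
      rw [h] at hcount
      rcases hM with rfl | rfl <;> split_ifs at hcount with hk
      · refine ⟨s, hs, Or.inl ?_⟩
        apply mul_right_cancel₀ hqz
        rw [hcount]; ring
      · refine ⟨-s, by rcases hs with rfl | rfl <;> simp, Or.inr (Or.inl ?_)⟩
        apply mul_right_cancel₀ hqz
        rw [hcount]; ring
      · refine ⟨s, hs, Or.inr (Or.inr (Or.inr (Or.inr ?_)))⟩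
        apply mul_right_cancel₀ hqz
        rw [hcount]; ring
      · refine ⟨-s, by rcases hs with rfl | rfl <;> simp, Or.inr (Or.inr (Or.inr (Or.inl ?_)))⟩
        apply mul_right_cancel₀ hqz
        rw [hcount]; ring
  · push Not at hL
    obtain ⟨r, hr, hr0⟩ := hL
    have hMq : M = q := by
      rcases hRc with h | h
      · exfalso
        have hbot : R = ⊥ := by
          have := Nat.card_eq_one_iff_unique.mp h
          have := this.1
          exact Submodule.subsingleton_iff_eq_bot.mp this
        rw [hbot, Submodule.mem_bot] at hr
        exact hr0 (by rw [hr, map_zero])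
      · rcases hM with h' | h'
        · rw [h, h'] at hRM
          have : q = 1 := by
            have h5 : q ^ 2 = 1 := by exact_mod_cast hRM
            simpa using h5
          rw [h', this]; rfl
        · exact h'
    subst hMq
    by_cases hex : ∃ m ∈ Finset.univ.erase (0 : K), ∑ v : V, χ (Q v + (m • L) v) ≠ 0
    · obtain ⟨m, hm, hm0⟩ := hex
      rw [Finset.sum_eq_single_of_mem m hm] at hcount
      · rcases hA (m • L) with ⟨h, -⟩ | ⟨⟨s, hs, h⟩, -⟩
        · exact absurd h hm0
        · rw [h] at hcount
          refine ⟨χ (m ^ 2 * k) * s, ?_, Or.inr (Or.inr (Or.inr (Or.inl ?_)))⟩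
          · rw [← sq_eq_one_iff]
            have := hsq (m ^ 2 * k)
            rcases hs with rfl | rfl <;> linear_combination this
          · apply mul_right_cancel₀ hqz
            rw [hcount]; ring
      · intro m' _ hmm
        rcases hA (m' • L) with ⟨h, -⟩ | ⟨-, h'⟩
        · rw [h, mul_zero]
        · exfalso
          rcases hA (m • L) with ⟨h, -⟩ | ⟨-, h''⟩
          · exact hm0 h
          · obtain ⟨t, ht⟩ := hne
            apply ht
            have hd : m' - m ≠ 0 := sub_ne_zero.mpr hmm
            set w := (t / ((m' - m) * L r)) • r with hw
            have hwR : w ∈ R := R.smul_mem _ hr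
            have e1 := h' w hwR
            have e2 := h'' w hwR
            have : t = (Q w + (m' • L) w) + (Q w + (m • L) w) := by
              have hLw : (m' - m) * L w = t := by
                rw [hw, map_smul, smul_eq_mul]
                field_simp
              simp only [LinearMap.smul_apply, smul_eq_mul]
              linear_combination (-(Q w) - m * L w) * h2 - hLw
            rw [this, hadd, e1, e2, one_mul]
    · push Not at hex
      refine ⟨1, Or.inl rfl, Or.inr (Or.inr (Or.inl ?_))⟩
      rw [Finset.sum_eq_zero (fun m hm => by rw [hex m hm, mul_zero])] at hcount
      apply mul_right_cancel₀ hqz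
      rw [hcount]; ring

end general

theorem aux_concrete
    (h q : ℕ) (hq : q = 2 ^ h)
    (F : Type) [Field F] [Fintype F] [CharP F 2] (hF : Fintype.card F = q ^ 2)
    (a b c d e f : F) (hh : 1 ≤ h) (N : ℕ)
    (hN : N = Nat.card {v : F × F //
      (a * v.1 ^ 2 + b * v.2 ^ 2 + c * v.1 * v.2 + d * v.1 + e * v.2 + f) ^ q +
      (a * v.1 ^ 2 + b * v.2 ^ 2 + c * v.1 * v.2 + d * v.1 + e * v.2 + f) +
      (v.1 ^ (q + 1) + v.2 ^ (q + 1)) = 0}) :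
    ∃ s : ℤ, (s = 1 ∨ s = -1) ∧ ((N : ℤ) = q ^ 3 + s * (q ^ 2 - q) ∨ (N : ℤ) = q ^ 3 + s * q ∨
      (N : ℤ) = q ^ 3 ∨ (N : ℤ) = q ^ 3 + s * q ^ 2 ∨ (N : ℤ) = q ^ 3 + s * (q ^ 3 - q ^ 2)) := by
  classical
  have h2 : (2 : F) = 0 := CharTwo.two_eq_zero
  have hq0 : 0 < q := by rw [hq]; positivity
  have hq2 : 2 ≤ q := by
    rw [hq]
    calc 2 = 2 ^ 1 := by norm_num
      _ ≤ 2 ^ h := Nat.pow_le_pow_right (by norm_num) hh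
  have hfadd : ∀ x y : F, (x + y) ^ q = x ^ q + y ^ q := by
    intro x y
    rw [hq]
    exact add_pow_char_pow x y 2 h
  have hqq : ∀ x : F, (x ^ q) ^ q = x := by
    intro x
    rw [← pow_mul, ← sq, ← hF]
    exact FiniteField.pow_card x
  let K : Subfield F := RingHom.eqLocusField (iterateFrobenius F 2 h) (RingHom.id F)
  have hKmem : ∀ x : F, x ∈ K ↔ x ^ q = x := by
    intro x
    rw [hq]
    rfl
  have hKp : ∀ x : K, (x : F) ^ q = x := fun x => (hKmem x).mp x.2
  have : CharP K 2 := (algebraMap K F).charP (algebraMap K F).injective 2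
  let T : F →ₗ[K] K :=
    { toFun := fun z => ⟨z ^ q + z, by rw [hKmem, hfadd, hqq]; ring⟩
      map_add' := fun x y => by
        apply Subtype.ext
        simp only [Subfield.coe_add, hfadd]
        ring
      map_smul' := fun s x => by
        apply Subtype.ext
        simp only [RingHom.id_apply, smul_eq_mul, Subfield.coe_mul, Subfield.smul_def, mul_pow, hKp]
        ring }
  have hT : ∀ z, (T z : F) = z ^ q + z := fun z => rfl
  -- number of roots of z^q + z
  have hkercard : Nat.card K ≤ q := by
    let p : Polynomial F := Polynomial.X ^ q - Polynomial.X
    have hp : p ≠ 0 := FiniteField.X_pow_card_sub_X_ne_zero F (by omega)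
    have hd : p.natDegree = q := FiniteField.X_pow_card_sub_X_natDegree_eq F (by omega)
    calc Nat.card K ≤ Nat.card p.roots.toFinset := by
          refine Nat.card_le_card_of_injective (fun x : K => ⟨(x : F), ?_⟩) ?_
          · rw [Multiset.mem_toFinset, Polynomial.mem_roots hp]
            simp only [p, Polynomial.IsRoot.def, Polynomial.eval_sub, Polynomial.eval_pow,
              Polynomial.eval_X]
            rw [hKp, sub_self]
          · intro x y hxy
            exact Subtype.ext (congrArg (fun z => z.1) hxy)
      _ = p.roots.toFinset.card := Nat.card_eq_card_toFinset _ |>.trans (by simp)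
      _ ≤ Multiset.card p.roots := Multiset.toFinset_card_le _
      _ ≤ p.natDegree := p.card_roots'
      _ = q := hd
  have hkerK : Nat.card (LinearMap.ker T) = Nat.card K := by
    refine Nat.card_congr (Equiv.subtypeEquivRight (fun x => ?_))
    rw [LinearMap.mem_ker, Subtype.ext_iff, hT]
    change _ = (0 : F) ↔ x ∈ K
    rw [hKmem, CharTwo.add_eq_zero]
  have hprod : Nat.card F = Nat.card (LinearMap.ker T) * Nat.card (LinearMap.range T) := by
    rw [Submodule.card_eq_card_quotient_mul_card (LinearMap.ker T), mul_comm,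
      Nat.card_congr T.quotKerEquivRange.toEquiv]
    ring
  have hKcard : Nat.card K = q := by
    have h1 : Nat.card (LinearMap.range T) ≤ Nat.card K :=
      Nat.card_le_card_of_injective _ Subtype.val_injective
    rw [hkerK, Nat.card_eq_fintype_card, hF] at hprod
    by_contra hcon
    have h3 : Nat.card K < q := lt_of_le_of_ne hkercard hcon
    nlinarith
  have hTne : ∃ t, T t ≠ 0 := by
    by_contra hcon
    push Not at hcon
    have : LinearMap.ker T = ⊤ := by
      rw [LinearMap.ker_eq_top]; ext x; simp [hcon]
    rw [this, hKcard] at hkerK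
    have h3 : Nat.card (⊤ : Submodule K F) = q ^ 2 := by
      rw [← hF, ← Nat.card_eq_fintype_card]
      exact Nat.card_congr (Equiv.Set.univ F)
    rw [h3] at hkerK
    nlinarith
  have hTnd : ∀ u, (∀ x, T (x * u) = 0) → u = 0 := by
    intro u hu
    by_contra hu0
    obtain ⟨t, ht⟩ := hTne
    apply ht
    have := hu (t / u)
    rwa [div_mul_cancel₀ _ hu0] at this
  have hTq : ∀ z, T (z ^ q) = T z := by
    intro z
    apply Subtype.ext
    rw [hT, hT, hqq, add_comm]
  let Nm : F → K := fun x => ⟨x ^ (q + 1), by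
    rw [hKmem, pow_succ, mul_pow, hqq, mul_comm]⟩
  have hNm : ∀ x, (Nm x : F) = x ^ q * x := fun x => pow_succ x q
  let Q : F × F → K := fun v => T (a * v.1 ^ 2 + b * v.2 ^ 2 + c * v.1 * v.2) + (Nm v.1 + Nm v.2)
  let B : (F × F) →ₗ[K] (F × F) →ₗ[K] K := LinearMap.mk₂ K
    (fun v w => T (c * (v.1 * w.2 + w.1 * v.2) + v.1 * w.1 ^ q + v.2 * w.2 ^ q))
    (fun v v' w => by
      rw [← map_add]; congr 1
      simp only [Prod.fst_add, Prod.snd_add]; ring)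
    (fun s v w => by
      rw [← map_smul]; congr 1
      simp only [Prod.smul_fst, Prod.smul_snd, Subfield.smul_def, smul_eq_mul]; ring)
    (fun v w w' => by
      rw [← map_add]; congr 1
      simp only [Prod.fst_add, Prod.snd_add, hfadd]; ring)
    (fun s v w => by
      rw [← map_smul]; congr 1
      simp only [Prod.smul_fst, Prod.smul_snd, Subfield.smul_def, smul_eq_mul, mul_pow, hKp]; ring)
  have hBdef : ∀ v w, B v w = T (c * (v.1 * w.2 + w.1 * v.2) + v.1 * w.1 ^ q + v.2 * w.2 ^ q) :=
    fun v w => rfl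
  let L : (F × F) →ₗ[K] K :=
    { toFun := fun v => T (d * v.1 + e * v.2)
      map_add' := fun v w => by
        rw [← map_add]; congr 1
        simp only [Prod.fst_add, Prod.snd_add]; ring
      map_smul' := fun s v => by
        rw [RingHom.id_apply, ← map_smul]; congr 1
        simp only [Prod.smul_fst, Prod.smul_snd, Subfield.smul_def, smul_eq_mul]; ring }
  have hBsymm : ∀ v w, B v w = B w v := by
    intro v w
    rw [hBdef, hBdef]
    apply Subtype.ext
    simp only [hT, hfadd, mul_pow, hqq]
    ring
  have hR : ∀ w, w ∈ LinearMap.ker B ↔ ∀ v, B v w = 0 := by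
    intro w
    rw [LinearMap.mem_ker]
    constructor
    · intro hw v
      rw [hBsymm, hw]; rfl
    · intro hw
      ext1 <;> ext <;> simp [hBsymm w, hw]
  have hR2 : ∀ w : F × F, w ∈ LinearMap.ker B ↔ w.1 ^ q = c * w.2 ∧ w.2 ^ q = c * w.1 := by
    intro w
    rw [hR]
    constructor
    · intro hw
      constructor
      · rw [← CharTwo.add_eq_zero]
        apply hTnd
        intro x
        have := hw (x, 0)
        rw [hBdef] at this
        rw [← this]
        congr 1
        simp
        ring
      · rw [← CharTwo.add_eq_zero]
        apply hTnd
        intro x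
        have := hw (0, x)
        rw [hBdef] at this
        rw [← this]
        congr 1
        simp
        ring
    · rintro ⟨h3, h4⟩ v
      rw [hBdef, h3, h4]
      have : c * (v.1 * w.2 + w.1 * v.2) + v.1 * (c * w.2) + v.2 * (c * w.1) = 0 := by
        linear_combination (c * (v.1 * w.2 + w.1 * v.2)) * h2
      rw [this, map_zero]
  have hRc : Nat.card (LinearMap.ker B) = 1 ∨ Nat.card (LinearMap.ker B) = q ^ 2 := by
    by_cases hc1 : c ^ q * c = 1
    · right
      have hc0 : c ≠ 0 := by
        rintro rfl
        simp at hc1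
      rw [← hF, ← Nat.card_eq_fintype_card]
      refine Nat.card_congr
        { toFun := fun w => w.1.1
          invFun := fun x => ⟨(x, x ^ q / c), ?_⟩
          left_inv := ?_
          right_inv := ?_ }
      · rw [hR2]
        refine ⟨by field_simp, ?_⟩
        simp only [div_pow, hqq]
        rw [div_eq_iff (pow_ne_zero _ hc0)]
        linear_combination (-x) * hc1
      · intro w
        apply Subtype.ext
        have := ((hR2 w.1).mp w.2).1
        refine Prod.ext rfl ?_
        simp only [this]
        field_simp
      · intro x
        rfl
    · left
      have : LinearMap.ker B = ⊥ := by
        rw [Submodule.eq_bot_iff]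
        intro w hw
        obtain ⟨h3, h4⟩ := (hR2 w).mp hw
        have h5 : w.1 = 0 := by
          have h6 : (w.1 ^ q) ^ q = (c * w.2) ^ q := by rw [h3]
          rw [hqq, mul_pow, h4] at h6
          have h7 : (c ^ q * c - 1) * w.1 = 0 := by linear_combination -h6
          rcases mul_eq_zero.mp h7 with h8 | h8
          · exact absurd (sub_eq_zero.mp h8) hc1
          · exact h8
        rw [h5, mul_zero] at h4
        exact Prod.ext h5 (pow_eq_zero_iff hq0.ne' |>.mp h4)
      rw [this]
      simp
  refine aux_general (K := K) (V := F × F) q hq0 (by rw [← Nat.card_eq_fintype_card, hKcard])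
    (by rw [Fintype.card_prod, hF]; ring) Q B ?_ ?_ L (T f) (LinearMap.ker B) hR hBsymm hRc N ?_
  · intro v w
    apply Subtype.ext
    rw [hBdef]
    simp only [Q, Subfield.coe_add, hT, hNm, hfadd, mul_pow, hqq, Prod.fst_add, Prod.snd_add]
    have hs : ∀ x y : F, ((x + y) ^ 2) ^ q = (x ^ 2) ^ q + (y ^ 2) ^ q := by
      intro x y
      rw [← hfadd]
      congr 1
      linear_combination x * y * h2
    simp only [hs]
    linear_combination (a * v.1 * w.1 + b * v.2 * w.2) * h2
  · intro s v
    apply Subtype.ext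
    simp only [Q, Subfield.coe_add, Subfield.coe_mul, SubmonoidClass.coe_pow, hT, hNm, hfadd, mul_pow,
      Prod.smul_fst, Prod.smul_snd, Subfield.smul_def, smul_eq_mul, hKp]
    have hs : ((s : F) ^ 2) ^ q = (s : F) ^ 2 := by rw [← pow_mul, mul_comm, pow_mul, hKp]
    rw [hs]
    ring
  · rw [hN]
    refine Nat.card_congr (Equiv.subtypeEquivRight (fun v => ?_))
    rw [Subtype.ext_iff]
    change _ ↔ ((T (a * v.1 ^ 2 + b * v.2 ^ 2 + c * v.1 * v.2) + (Nm v.1 + Nm v.2)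
      + T (d * v.1 + e * v.2) + T f : K) : F) = 0
    simp only [Subfield.coe_add, hT, hNm, hfadd, pow_succ _ q]
    apply Eq.congr_left
    ring

end helpers

/-- Lemma 3.2 of the paper (hyperbolic case): the number of affine points of
`ℋ ∩ 𝒬` when `c ≠ 0` and `Tr(ab/c²) = 0`. -/
theorem stmt_7
    (h q : ℕ) (hh : 1 ≤ h) (hq : q = 2 ^ h)
    (F : Type) [Field F] [Fintype F] (hF : Fintype.card F = q ^ 2)
    (a b c d e f : F) (hc : c ≠ 0)
    (htr : ∑ i ∈ Finset.range (2 * h), (a * b / c ^ 2) ^ 2 ^ i = 0) :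
    Set.ncard {t : F × F × F |
        t.2.2 ^ q + t.2.2 = t.1 ^ (q + 1) + t.2.1 ^ (q + 1) ∧
        t.2.2 = a * t.1 ^ 2 + b * t.2.1 ^ 2 + c * t.1 * t.2.1
            + d * t.1 + e * t.2.1 + f} ∈
      ({q ^ 2, q ^ 3 - q ^ 2, q ^ 3 - q ^ 2 + q, q ^ 3 - q, q ^ 3, q ^ 3 + q,
        q ^ 3 + q ^ 2 - q, q ^ 3 + q ^ 2, 2 * q ^ 3 - q ^ 2} : Set ℕ) := by
  have hchar : CharP F 2 := by
    have : Fact (Nat.Prime 2) := ⟨Nat.prime_two⟩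
    apply charP_of_card_eq_prime_pow (f := h * 2)
    rw [hF, hq, pow_mul]
  have hq2 : 2 ≤ q := by
    rw [hq]
    calc 2 = 2 ^ 1 := by norm_num
      _ ≤ 2 ^ h := Nat.pow_le_pow_right (by norm_num) hh
  obtain ⟨s, hs, hN⟩ := aux_concrete h q hq F hF a b c d e f hh _ rfl
  have hcard : Set.ncard {t : F × F × F |
        t.2.2 ^ q + t.2.2 = t.1 ^ (q + 1) + t.2.1 ^ (q + 1) ∧
        t.2.2 = a * t.1 ^ 2 + b * t.2.1 ^ 2 + c * t.1 * t.2.1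
            + d * t.1 + e * t.2.1 + f} = Nat.card {v : F × F //
      (a * v.1 ^ 2 + b * v.2 ^ 2 + c * v.1 * v.2 + d * v.1 + e * v.2 + f) ^ q +
      (a * v.1 ^ 2 + b * v.2 ^ 2 + c * v.1 * v.2 + d * v.1 + e * v.2 + f) +
      (v.1 ^ (q + 1) + v.2 ^ (q + 1)) = 0} := by
    rw [← Nat.card_coe_set_eq]
    refine Nat.card_congr
      { toFun := fun t => ⟨(t.1.1, t.1.2.1), ?_⟩
        invFun := fun v => ⟨(v.1.1, v.1.2, a * v.1.1 ^ 2 + b * v.1.2 ^ 2 + c * v.1.1 * v.1.2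
          + d * v.1.1 + e * v.1.2 + f), ?_⟩
        left_inv := ?_
        right_inv := ?_ }
    · obtain ⟨h1, h2⟩ := t.2
      rw [CharTwo.add_eq_zero, ← h1]
      simp only [← h2]
    · exact ⟨CharTwo.add_eq_zero.mp v.2, rfl⟩
    · intro t
      apply Subtype.ext
      exact Prod.ext rfl (Prod.ext rfl t.2.2.symm)
    · intro v
      rfl
  rw [hcard]
  generalize Nat.card {v : F × F //
      (a * v.1 ^ 2 + b * v.2 ^ 2 + c * v.1 * v.2 + d * v.1 + e * v.2 + f) ^ q +
      (a * v.1 ^ 2 + b * v.2 ^ 2 + c * v.1 * v.2 + d * v.1 + e * v.2 + f) +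
      (v.1 ^ (q + 1) + v.2 ^ (q + 1)) = 0} = N at hN ⊢
  have e1 : q ≤ q ^ 2 := by nlinarith
  have e2 : q ^ 2 ≤ q ^ 3 := Nat.pow_le_pow_right (by omega) (by norm_num)
  simp only [Set.mem_insert_iff, Set.mem_singleton_iff]
  have c2 : ((q : ℤ)) ^ 2 = ((q ^ 2 : ℕ) : ℤ) := by push_cast; rfl
  have c3 : ((q : ℤ)) ^ 3 = ((q ^ 3 : ℕ) : ℤ) := by push_cast; rfl
  rw [c2, c3] at hN
  clear c2 c3 hcard hF hq
  generalize q ^ 2 = q2 at *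
  generalize q ^ 3 = q3 at *
  rcases hs with rfl | rfl <;> omega
end

section
/- Let q = 2^h (h ≥ 1) and F = GF(q²). Let a,b,c,d,e,f ∈ F define an irreducible quadric 𝒬 (i.e. either c ≠ 0, or c = 0 and (a,b) ≠ (0,0)). If the number of points of ℙ³(F) lying on both ℋ and 𝒬 equals 2q³ + q² + 1, then c ≠ 0 and Tr(ab/c²) = 0 (that is, 𝒬 is a hyperbolic quadric). -/
open Polynomial in
/-- The fibre polynomial. -/
noncomputable def fibPoly {F : Type} [Field F] (q : ℕ) (A B M : F) : F[X] :=
  C (A ^ q) * X ^ (2 * q) + X ^ (q + 1) + C A * X ^ 2 + C (B ^ q) * X ^ q + C B * X + C M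

open Polynomial in
lemma fibPoly_natDegree {F : Type} [Field F] (q : ℕ) (hq : 2 ≤ q) (A B M : F) :
    (fibPoly q A B M).natDegree ≤ 2 * q := by
  unfold fibPoly
  have h1 : q + 1 ≤ 2 * q := by omega
  have h2 : 2 ≤ 2 * q := by omega
  have h3 : q ≤ 2 * q := by omega
  have h4 : 1 ≤ 2 * q := by omega
  refine natDegree_add_le_of_degree_le (natDegree_add_le_of_degree_le
    (natDegree_add_le_of_degree_le (natDegree_add_le_of_degree_le
    (natDegree_add_le_of_degree_le ?_ ?_) ?_) ?_) ?_) ?_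
  · exact natDegree_C_mul_X_pow_le _ _
  · simpa using h1
  · exact (natDegree_C_mul_X_pow_le _ _).trans h2
  · exact (natDegree_C_mul_X_pow_le _ _).trans h3
  · exact (natDegree_C_mul_le _ _).trans (by simpa using h4)
  · simp

open Polynomial in
lemma fibPoly_ne_zero {F : Type} [Field F] (q : ℕ) (hq : 2 ≤ q) (A B M : F) :
    fibPoly q A B M ≠ 0 := by
  intro h0
  have := congrArg (fun p => coeff p (q + 1)) h0
  have e1 : q + 1 ≠ 2 * q := by omega
  have e2 : q + 1 ≠ 2 := by omega
  have e3 : ¬ q = 0 := by omega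
  have e4 : ¬ 1 = q + 1 := by omega
  have e5 : ¬ q + 1 = q := by omega
  have e6 : ¬ q + 1 = 0 := by omega
  simp only [fibPoly, coeff_add, coeff_C_mul, coeff_X_pow, coeff_X, coeff_C, coeff_zero,
    if_neg e1, if_neg e2, if_neg e4, if_neg e5, if_neg e6, if_true] at this
  simp at this

open Polynomial in
lemma fib_card {F : Type} [Field F] [Fintype F] [DecidableEq F] (q : ℕ) (hq : 2 ≤ q)
    (A B M : F) :
    (Finset.univ.filter fun x : F => (fibPoly q A B M).eval x = 0).card ≤ 2 * q := by
  have : (Finset.univ.filter fun x : F => (fibPoly q A B M).eval x = 0)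
      = (fibPoly q A B M).roots.toFinset := by
    ext x
    simp [fibPoly_ne_zero q hq]
  rw [this]
  exact (Multiset.toFinset_card_le _).trans
    ((card_roots' _).trans (fibPoly_natDegree q hq A B M))

open Polynomial in
lemma fib_card_lt {F : Type} [Field F] [Fintype F] [DecidableEq F] (q : ℕ) (hq : 2 ≤ q)
    (h2 : (2 : F) = 0) (hq0 : (q : F) = 0)
    (A B M s : F) (hs : s ^ q + B = 0) (hr : (fibPoly q A B M).eval s = 0) :
    (Finset.univ.filter fun x : F => (fibPoly q A B M).eval x = 0).card < 2 * q := by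
  have : (Finset.univ.filter fun x : F => (fibPoly q A B M).eval x = 0)
      = (fibPoly q A B M).roots.toFinset := by
    ext x
    simp [fibPoly_ne_zero q hq]
  rw [this]
  refine lt_of_lt_of_le (lt_of_le_of_ne (Multiset.toFinset_card_le _) ?_)
    ((card_roots' _).trans (fibPoly_natDegree q hq A B M))
  intro heq
  have hnd := Multiset.toFinset_card_eq_card_iff_nodup.mp heq
  have hc := Multiset.nodup_iff_count_le_one.mp hnd s
  rw [count_roots] at hc
  have : 1 < (fibPoly q A B M).rootMultiplicity s := by
    rw [one_lt_rootMultiplicity_iff_isRoot (fibPoly_ne_zero q hq A B M)]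
    refine ⟨hr, ?_⟩
    simp only [fibPoly, IsRoot, derivative_add, derivative_C_mul, derivative_X_pow, derivative_X,
      derivative_C, eval_add, eval_mul, eval_C, eval_pow, eval_X, eval_zero, eval_one,
      Nat.cast_add, Nat.cast_mul, Nat.cast_one, Nat.cast_ofNat, hq0, h2, Nat.add_sub_cancel]
    linear_combination hs
  omega

/-- The affine equation. -/
def affEq {F : Type} [Field F] (q : ℕ) (a b c d e f x y : F) : Prop :=
  x ^ (q + 1) + y ^ (q + 1)
    + (a * x ^ 2 + b * y ^ 2 + c * x * y + d * x + e * y + f) ^ q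
    + (a * x ^ 2 + b * y ^ 2 + c * x * y + d * x + e * y + f) = 0

open Polynomial in
lemma affEq_iff {F : Type} [Field F] [CharP F 2] (h q : ℕ) (hq : q = 2 ^ h)
    (a b c d e f x y : F) :
    affEq q a b c d e f x y ↔ (fibPoly q a (c * y + d)
      (y ^ (q + 1) + (b * y ^ 2 + e * y + f) ^ q + (b * y ^ 2 + e * y + f))).eval x = 0 := by
  unfold affEq fibPoly
  have hadd : ∀ u v : F, (u + v) ^ q = u ^ q + v ^ q := fun u v => by
    rw [hq]; exact add_pow_char_pow u v 2 h
  have h1 : a * x ^ 2 + b * y ^ 2 + c * x * y + d * x + e * y + f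
      = a * x ^ 2 + (c * y + d) * x + (b * y ^ 2 + e * y + f) := by ring
  rw [h1, hadd (a * x ^ 2 + (c * y + d) * x), hadd (a * x ^ 2)]
  simp only [eval_add, eval_mul, eval_C, eval_pow, eval_X, mul_pow]
  rw [← pow_mul]
  constructor <;> intro hh <;> rw [← hh] <;> ring

lemma affEq_symm {F : Type} [Field F] (q : ℕ) (a b c d e f x y : F) :
    affEq q a b c d e f x y ↔ affEq q b a c e d f y x := by
  unfold affEq
  have : a * x ^ 2 + b * y ^ 2 + c * x * y + d * x + e * y + f
    = b * y ^ 2 + a * x ^ 2 + c * y * x + e * y + d * x + f := by ring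
  rw [this, add_comm (x ^ (q + 1))]

open Classical in
lemma row_card {F : Type} [Field F] [Fintype F] [CharP F 2] (h q : ℕ) (hh : 1 ≤ h)
    (hq : q = 2 ^ h) (a b c d e f y : F) :
    (Finset.univ.filter fun x : F => affEq q a b c d e f x y).card ≤ 2 * q := by
  have h2 : 2 ≤ q := by rw [hq]; exact Nat.le_self_pow (by omega) 2
  simp only [affEq_iff h q hq]
  exact fib_card q h2 _ _ _

open Classical in
lemma aff_card {F : Type} [Field F] [Fintype F] (q : ℕ) (a b c d e f : F) :
    (Finset.univ.filter fun p : F × F => affEq q a b c d e f p.1 p.2).card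
      = ∑ y : F, (Finset.univ.filter fun x : F => affEq q a b c d e f x y).card := by
  simp only [Finset.card_filter]
  rw [Fintype.sum_prod_type_right]

open Classical in
lemma aff_card' {F : Type} [Field F] [Fintype F] (q : ℕ) (a b c d e f : F) :
    (Finset.univ.filter fun p : F × F => affEq q a b c d e f p.1 p.2).card
      = ∑ x : F, (Finset.univ.filter fun y : F => affEq q b a c e d f y x).card := by
  simp only [Finset.card_filter]
  rw [Fintype.sum_prod_type]
  simp only [← affEq_symm q a b c d e f]

open Classical in
lemma aff_le {F : Type} [Field F] [Fintype F] [CharP F 2] (h q : ℕ) (hh : 1 ≤ h)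
    (hq : q = 2 ^ h) (hF : Fintype.card F = q ^ 2) (a b c d e f : F) :
    (Finset.univ.filter fun p : F × F => affEq q a b c d e f p.1 p.2).card ≤ 2 * q ^ 3 := by
  rw [aff_card]
  refine (Finset.sum_le_card_nsmul _ _ (2 * q) fun y _ => row_card h q hh hq _ _ _ _ _ _ y).trans ?_
  rw [Finset.card_univ, hF, smul_eq_mul]
  apply le_of_eq; ring

open Classical in
lemma aff_lt {F : Type} [Field F] [Fintype F] [CharP F 2] (h q : ℕ) (hh : 1 ≤ h)
    (hq : q = 2 ^ h) (hF : Fintype.card F = q ^ 2) (a b d e f : F) :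
    (Finset.univ.filter fun p : F × F => affEq q a b 0 d e f p.1 p.2).card < 2 * q ^ 3 := by
  have h2 : 2 ≤ q := by rw [hq]; exact Nat.le_self_pow (by omega) 2
  have hch : (2 : F) = 0 := CharTwo.two_eq_zero
  have hq0 : (q : F) = 0 := by
    rw [hq]; push_cast; rw [hch, zero_pow (by omega)]
  have hS : ∑ _x : F, 2 * q = 2 * q ^ 3 := by
    rw [Finset.sum_const, Finset.card_univ, hF, smul_eq_mul]; ring
  have hs : (d ^ q) ^ q + d = 0 := by
    rw [← pow_mul, ← sq, ← hF, FiniteField.pow_card]; exact CharTwo.add_self_eq_zero d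
  by_cases hy : ∃ y, affEq q a b 0 d e f (d ^ q) y
  · obtain ⟨y, hy⟩ := hy
    rw [aff_card, ← hS]
    refine Finset.sum_lt_sum (fun y _ => row_card h q hh hq _ _ _ _ _ _ y) ⟨y, Finset.mem_univ _, ?_⟩
    rw [affEq_iff h q hq] at hy
    simp only [affEq_iff h q hq]
    exact fib_card_lt q h2 hch hq0 _ _ _ (d ^ q) (by rw [zero_mul, zero_add]; exact hs) hy
  · rw [aff_card', ← hS]
    refine Finset.sum_lt_sum (fun y _ => row_card h q hh hq _ _ _ _ _ _ y)
      ⟨d ^ q, Finset.mem_univ _, ?_⟩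
    rw [Finset.filter_false_of_mem]
    · simp; omega
    · intro y _ hc
      exact hy ⟨y, (affEq_symm _ _ _ _ _ _ _ _ _).mpr hc⟩

lemma trace_zero {F : Type} [Field F] [Fintype F] [CharP F 2] (n : ℕ)
    (hF : Fintype.card F = 2 ^ n) (u : F) :
    ∑ i ∈ Finset.range n, (u ^ 2 + u) ^ 2 ^ i = 0 := by
  have : ∀ m : ℕ, ∑ i ∈ Finset.range m, (u ^ 2 + u) ^ 2 ^ i = u ^ 2 ^ m + u := by
    intro m
    induction m with
    | zero => simp [CharTwo.add_self_eq_zero]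
    | succ k ih =>
      rw [Finset.sum_range_succ, ih, add_pow_char_pow, ← pow_mul, pow_succ' 2 k]
      linear_combination (u ^ 2 ^ k) * (CharTwo.two_eq_zero : (2 : F) = 0)
  rw [this, ← hF, FiniteField.pow_card, CharTwo.add_self_eq_zero]

lemma form_aniso {F : Type} [Field F] [Fintype F] [CharP F 2] (n : ℕ) (hn : 1 ≤ n)
    (hF : Fintype.card F = 2 ^ n) (a b c x y : F) (hc : c ≠ 0)
    (ht : ∑ i ∈ Finset.range n, (a * b / c ^ 2) ^ 2 ^ i ≠ 0)
    (hxy : a * x ^ 2 + b * y ^ 2 + c * x * y = 0) : x = 0 ∧ y = 0 := by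
  have hch : (2 : F) = 0 := CharTwo.two_eq_zero
  by_cases hy : y = 0
  · subst hy
    refine ⟨?_, rfl⟩
    by_contra hx
    have ha : a = 0 := by simpa [hx] using hxy
    apply ht
    simp [ha]
  · exfalso
    apply ht
    have : a * b / c ^ 2 = (a * x / (c * y)) ^ 2 + a * x / (c * y) := by
      field_simp
      linear_combination (-a) * hxy + a * b * y ^ 2 * hch
    rw [this]
    exact trace_zero n hF _

lemma mk_of_rep {F : Type} [Field F] (p : Projectivization F (Fin 4 → F)) (v : Fin 4 → F)
    (hv : v ≠ 0) (t : F) (h : p.rep = t • v) : Projectivization.mk F v hv = p := by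
  conv_rhs => rw [← p.mk_rep]
  rw [Projectivization.mk_eq_mk_iff']
  have ht : t ≠ 0 := by
    rintro rfl
    exact p.rep_nonzero (by simpa using h)
  exact ⟨t⁻¹, by rw [h, smul_smul, inv_mul_cancel₀ ht, one_smul]⟩

/-- Total version of `mk`. -/
noncomputable def mk' {F : Type} [Field F] (v : Fin 4 → F) : Projectivization F (Fin 4 → F) :=
  open Classical in
  if hv : v ≠ 0 then Projectivization.mk F v hv
  else Projectivization.mk F (fun _ => 1) (fun h => one_ne_zero (congrFun h 0))

lemma mk'_of_rep {F : Type} [Field F] (p : Projectivization F (Fin 4 → F)) (v : Fin 4 → F)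
    (t : F) (h : p.rep = t • v) : mk' v = p := by
  have hv : v ≠ 0 := by
    rintro rfl
    exact p.rep_nonzero (by simpa using h)
  rw [mk', dif_pos hv]
  exact mk_of_rep p v hv t h

lemma rep_aff {F : Type} [Field F] [CharP F 2] (q : ℕ) (a b c d e f : F)
    (p : Projectivization F (Fin 4 → F)) (hj : p.rep 0 ≠ 0)
    (h1 : (p.rep 1) ^ (q + 1) + (p.rep 2) ^ (q + 1)
            + (p.rep 3) ^ q * p.rep 0 + p.rep 3 * (p.rep 0) ^ q = 0)
    (h2 : a * (p.rep 1) ^ 2 + b * (p.rep 2) ^ 2 + c * p.rep 1 * p.rep 2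
            + d * p.rep 1 * p.rep 0 + e * p.rep 2 * p.rep 0
            + f * (p.rep 0) ^ 2 + p.rep 0 * p.rep 3 = 0) :
    ∃ x y, affEq q a b c d e f x y ∧
      mk' ![1, x, y, a * x ^ 2 + b * y ^ 2 + c * x * y + d * x + e * y + f] = p := by
  have hch : (2 : F) = 0 := CharTwo.two_eq_zero
  have hz : a * (p.rep 1 / p.rep 0) ^ 2 + b * (p.rep 2 / p.rep 0) ^ 2
      + c * (p.rep 1 / p.rep 0) * (p.rep 2 / p.rep 0) + d * (p.rep 1 / p.rep 0)
      + e * (p.rep 2 / p.rep 0) + f = p.rep 3 / p.rep 0 := by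
    field_simp
    linear_combination h2 - p.rep 0 * p.rep 3 * hch
  refine ⟨p.rep 1 / p.rep 0, p.rep 2 / p.rep 0, ?_, ?_⟩
  · unfold affEq
    rw [hz]
    simp only [div_pow]
    field_simp
    linear_combination (p.rep 0) ^ (q + 1) * h1
  · rw [hz]
    refine mk'_of_rep p _ (p.rep 0) ?_
    ext i
    fin_cases i <;> simp <;> field_simp


/-- Theorem 5.2 of the paper: if an irreducible quadric `𝒬` (in the normal
form sharing the tangent plane `J = 0` with `ℋ` at `P∞`) meets `ℋ` in exactly
`2q³ + q² + 1` points, then `𝒬` is a hyperbolic quadric. -/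
theorem stmt_16
    (h q : ℕ) (hh : 1 ≤ h) (hq : q = 2 ^ h)
    (F : Type) [Field F] [Fintype F] (hF : Fintype.card F = q ^ 2)
    (a b c d e f : F)
    (hirr : c ≠ 0 ∨ (c = 0 ∧ ¬(a = 0 ∧ b = 0)))
    (hcount : Set.ncard {p : Projectivization F (Fin 4 → F) |
        (p.rep 1) ^ (q + 1) + (p.rep 2) ^ (q + 1)
            + (p.rep 3) ^ q * p.rep 0 + p.rep 3 * (p.rep 0) ^ q = 0 ∧
        a * (p.rep 1) ^ 2 + b * (p.rep 2) ^ 2 + c * p.rep 1 * p.rep 2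
            + d * p.rep 1 * p.rep 0 + e * p.rep 2 * p.rep 0
            + f * (p.rep 0) ^ 2 + p.rep 0 * p.rep 3 = 0}
      = 2 * q ^ 3 + q ^ 2 + 1) :
    c ≠ 0 ∧ ∑ i ∈ Finset.range (2 * h), (a * b / c ^ 2) ^ 2 ^ i = 0 := by
  classical
  have hF' : Fintype.card F = 2 ^ (2 * h) := by rw [hF, hq, ← pow_mul, mul_comm]
  haveI : Fact (Nat.Prime 2) := ⟨Nat.prime_two⟩
  haveI : CharP F 2 := charP_of_card_eq_prime_pow hF'
  have hch : (2 : F) = 0 := CharTwo.two_eq_zero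
  have h2 : 2 ≤ q := by rw [hq]; exact Nat.le_self_pow (by omega) 2
  have hqpos : 0 < q ^ 2 := by positivity
  set A : Finset (F × F) := Finset.univ.filter fun p : F × F => affEq q a b c d e f p.1 p.2
    with hA
  set I : Finset (Projectivization F (Fin 4 → F)) := A.image fun p =>
    mk' ![1, p.1, p.2, a * p.1 ^ 2 + b * p.2 ^ 2 + c * p.1 * p.2 + d * p.1 + e * p.2 + f] with hI
  have hIc : I.card ≤ A.card := Finset.card_image_le
  have hmemI : ∀ p : Projectivization F (Fin 4 → F), p.rep 0 ≠ 0 →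
      (p.rep 1) ^ (q + 1) + (p.rep 2) ^ (q + 1)
            + (p.rep 3) ^ q * p.rep 0 + p.rep 3 * (p.rep 0) ^ q = 0 →
      a * (p.rep 1) ^ 2 + b * (p.rep 2) ^ 2 + c * p.rep 1 * p.rep 2
            + d * p.rep 1 * p.rep 0 + e * p.rep 2 * p.rep 0
            + f * (p.rep 0) ^ 2 + p.rep 0 * p.rep 3 = 0 → p ∈ I := by
    intro p hj k1 k2
    obtain ⟨x, y, hxy, hp⟩ := rep_aff q a b c d e f p hj k1 k2
    rw [hI, Finset.mem_image]
    exact ⟨(x, y), by simp [hA, hxy], hp⟩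
  have hinf : ∀ p : Projectivization F (Fin 4 → F), p.rep 0 = 0 → p.rep 1 = 0 → p.rep 2 = 0 →
      mk' ![0, 0, 0, 1] = p := by
    intro p h0 h1 h2
    refine mk'_of_rep p _ (p.rep 3) ?_
    ext i
    fin_cases i <;> simp [h0, h1, h2]
  by_contra hcon
  by_cases hc : c = 0
  · subst hc
    have hab : ¬(a = 0 ∧ b = 0) := by simpa using hirr
    have hlt : A.card < 2 * q ^ 3 := aff_lt h q hh hq hF a b d e f
    obtain ⟨r, hr⟩ : ∃ r : F, r ^ 2 = a := by
      obtain ⟨r, hr⟩ := (FiniteField.isSquare_of_char_two (F := F) (CharP.ringChar_of_prime_eq_zero Nat.prime_two hch) a)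
      exact ⟨r, by rw [hr, sq]⟩
    obtain ⟨s, hs⟩ : ∃ s : F, s ^ 2 = b := by
      obtain ⟨r, hr⟩ := (FiniteField.isSquare_of_char_two (F := F) (CharP.ringChar_of_prime_eq_zero Nat.prime_two hch) b)
      exact ⟨r, by rw [hr, sq]⟩
    set L : Finset (Projectivization F (Fin 4 → F)) :=
      Finset.univ.image fun z : F => mk' ![0, s, r, z] with hL
    have hLc : L.card ≤ q ^ 2 := by
      rw [← hF]; exact Finset.card_image_le
    have hsub := Set.ncard_le_ncard (t := ((I ∪ (L ∪ {mk' ![0, 0, 0, 1]}) : Finset _) : Set _))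
      (s := {p : Projectivization F (Fin 4 → F) |
        (p.rep 1) ^ (q + 1) + (p.rep 2) ^ (q + 1)
            + (p.rep 3) ^ q * p.rep 0 + p.rep 3 * (p.rep 0) ^ q = 0 ∧
        a * (p.rep 1) ^ 2 + b * (p.rep 2) ^ 2 + 0 * p.rep 1 * p.rep 2
            + d * p.rep 1 * p.rep 0 + e * p.rep 2 * p.rep 0
            + f * (p.rep 0) ^ 2 + p.rep 0 * p.rep 3 = 0}) (by
        rintro p ⟨k1, k2⟩
        simp only [Finset.coe_union, Set.mem_union, Finset.mem_coe, Finset.mem_singleton]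
        by_cases hj : p.rep 0 = 0
        · right
          have k3 : (r * p.rep 1 + s * p.rep 2) ^ 2 = 0 := by
            rw [hj] at k2
            linear_combination k2 + (p.rep 1) ^ 2 * hr + (p.rep 2) ^ 2 * hs
              + r * s * p.rep 1 * p.rep 2 * hch
          have k4 : r * p.rep 1 + s * p.rep 2 = 0 := by simpa using k3
          by_cases h0 : p.rep 1 = 0 ∧ p.rep 2 = 0
          · right
            exact (hinf p hj h0.1 h0.2).symm
          · left
            obtain ⟨t, ht1, ht2⟩ : ∃ t : F, p.rep 1 = t * s ∧ p.rep 2 = t * r := by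
              by_cases hr0 : r = 0
              · have hs0 : s ≠ 0 := by
                  rintro rfl
                  exact hab ⟨by rw [← hr, hr0]; simp, by rw [← hs]; simp⟩
                refine ⟨p.rep 1 / s, by field_simp, ?_⟩
                rw [hr0] at k4 ⊢
                simpa [hs0] using k4
              · refine ⟨p.rep 2 / r, ?_, by field_simp⟩
                field_simp
                linear_combination k4 - s * p.rep 2 * hch
            have ht : t ≠ 0 := by
              rintro rfl
              exact h0 ⟨by simpa using ht1, by simpa using ht2⟩
            rw [hL, Finset.mem_image]
            refine ⟨p.rep 3 / t, Finset.mem_univ _, mk'_of_rep p _ t ?_⟩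
            ext i
            fin_cases i <;> simp [hj, ht1, ht2]
            field_simp
        · left
          exact hmemI p hj k1 k2) (Finset.finite_toSet _)
    rw [hcount, Set.ncard_coe_finset] at hsub
    have u1 := Finset.card_union_le I (L ∪ {mk' ![0, 0, 0, 1]})
    have u2 := Finset.card_union_le L {mk' ![0, 0, 0, 1]}
    rw [Finset.card_singleton] at u2
    omega
  · have ht : ∑ i ∈ Finset.range (2 * h), (a * b / c ^ 2) ^ 2 ^ i ≠ 0 := fun h0 => hcon ⟨hc, h0⟩
    have hle : A.card ≤ 2 * q ^ 3 := aff_le h q hh hq hF a b c d e f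
    have hsub := Set.ncard_le_ncard (t := ((I ∪ {mk' ![0, 0, 0, 1]} : Finset _) : Set _))
      (s := {p : Projectivization F (Fin 4 → F) |
        (p.rep 1) ^ (q + 1) + (p.rep 2) ^ (q + 1)
            + (p.rep 3) ^ q * p.rep 0 + p.rep 3 * (p.rep 0) ^ q = 0 ∧
        a * (p.rep 1) ^ 2 + b * (p.rep 2) ^ 2 + c * p.rep 1 * p.rep 2
            + d * p.rep 1 * p.rep 0 + e * p.rep 2 * p.rep 0
            + f * (p.rep 0) ^ 2 + p.rep 0 * p.rep 3 = 0}) (by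
        rintro p ⟨k1, k2⟩
        simp only [Finset.coe_union, Set.mem_union, Finset.mem_coe, Finset.mem_singleton]
        by_cases hj : p.rep 0 = 0
        · right
          have k3 : a * (p.rep 1) ^ 2 + b * (p.rep 2) ^ 2 + c * p.rep 1 * p.rep 2 = 0 := by
            rw [hj] at k2
            linear_combination k2
          obtain ⟨e1, e2⟩ := form_aniso (2 * h) (by omega) hF' a b c _ _ hc ht k3
          exact (hinf p hj e1 e2).symm
        · left
          exact hmemI p hj k1 k2) (Finset.finite_toSet _)
    rw [hcount, Set.ncard_coe_finset] at hsub
    have u1 := Finset.card_union_le I {mk' ![0, 0, 0, 1]}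
    rw [Finset.card_singleton] at u1
    omega
end
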